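/- Let (M,l,r) be a bimodule over an anti-flexible algebra (A,·), let N : A → A be a Nijenhuis operator, and let S ∈ End(M) satisfy l(N(a))S(m) = S(l(N(a))m + l(a)S(m) − S(l(a)m)) and r(N(a))S(m) = S(r(N(a))m + r(a)S(m) − S(r(a)m)) for all a ∈ A, m ∈ M. Define ω(a,b) = N(a)·b + a·N(b) − N(a·b), φ(a) = l(N(a)) + l(a)∘S − S∘l(a), and ψ(a) = r(N(a)) + r(a)∘S − S∘r(a). Then for every scalar t, the product a ·_t b = a·b + tω(a,b) makes A an anti-flexible algebra and (M, l + tφ, r + tψ) is a bimodule over (A, ·_t). -/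

import Mathlib

/-- The anti-flexible identity for a (bilinear) product. -/
def AntiFlexible {A : Type*} [AddCommGroup A] (mul : A → A → A) : Prop :=
  ∀ a b c : A, mul (mul a b) c - mul a (mul b c) = mul (mul c b) a - mul c (mul b a)

/-- The bimodule equations for `(M, l, r)` over `(A, mul)`. -/
def IsBimodule {K A M : Type*} [Field K] [AddCommGroup A] [Module K A]
    [AddCommGroup M] [Module K M]
    (mul : A →ₗ[K] A →ₗ[K] A) (l r : A →ₗ[K] Module.End K M) : Prop :=
  (∀ a b : A, l (mul a b) - l a * l b = r a * r b - r (mul b a)) ∧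
  (∀ a b : A, l a * r b - r b * l a = l b * r a - r a * l b)

/-- The pointwise bimodule equations for plain maps `l, r : A → M → M` over a plain
product `mul : A → A → A`. -/
def IsBimodulePt {A M : Type*} [AddCommGroup A] [AddCommGroup M]
    (mul : A → A → A) (l r : A → M → M) : Prop :=
  (∀ (a b : A) (m : M),
    l (mul a b) m - l a (l b m) = r a (r b m) - r (mul b a) m) ∧
  (∀ (a b : A) (m : M),
    l a (r b m) - r b (l a m) = l b (r a m) - r a (l b m))

/-- Nijenhuis operator on `(A, mul)`. -/
def IsNijenhuis {A : Type*} [AddCommGroup A] (mul : A → A → A) (N : A → A) : Prop :=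
  ∀ a b : A, mul (N a) (N b) = N (mul (N a) b + mul a (N b) - N (mul a b))

/-- If `α` and `β` are compatible with operators in the Nijenhuis sense, the composite of their
first-order deformations is a quadratic polynomial in `t` whose coefficients depend only on the
undeformed composite `β (α u v) w` and on the operators. -/
theorem deformed_comp_eq {K U V W P Q : Type*} [CommRing K]
    [AddCommGroup U] [Module K U] [AddCommGroup V] [Module K V] [AddCommGroup W] [Module K W]
    [AddCommGroup P] [Module K P] [AddCommGroup Q] [Module K Q]
    (α : U →ₗ[K] V →ₗ[K] P) (β : P →ₗ[K] W →ₗ[K] Q)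
    (NU : Module.End K U) (NV : Module.End K V) (NW : Module.End K W)
    (NP : Module.End K P) (NQ : Module.End K Q)
    (hα : ∀ u v, α (NU u) (NV v) = NP (α (NU u) v + α u (NV v) - NP (α u v)))
    (hβ : ∀ p w, β (NP p) (NW w) = NQ (β (NP p) w + β p (NW w) - NQ (β p w)))
    (t : K) (u : U) (v : V) (w : W) (p : P)
    (hp : p = α u v + t • (α (NU u) v + α u (NV v) - NP (α u v))) :
    β p w + t • (β (NP p) w + β p (NW w) - NQ (β p w)) =
      β (α u v) w
      + t • (β (α (NU u) v) w + β (α u (NV v)) w + β (α u v) (NW w) - NQ (β (α u v) w))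
      + t • t • (β (α (NU u) (NV v)) w + β (α (NU u) v) (NW w) + β (α u (NV v)) (NW w)
        - (NQ (β (α (NU u) v) w) + NQ (β (α u (NV v)) w) + NQ (β (α u v) (NW w)))
        + NQ (NQ (β (α u v) w))) := by
  have h₁ := congrArg (fun x => β x w) (hα u v)
  have h₂ := hβ (α u v) w
  subst hp
  simp only [map_add, map_sub, map_smul, LinearMap.add_apply, LinearMap.sub_apply,
    LinearMap.smul_apply] at h₁ h₂ ⊢
  linear_combination (norm := module) (-(t * t)) • h₁ - (t * t) • h₂

/-- The quadratic polynomial in `t` of `deformed_comp_eq`, for a function `T` of three variables. -/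
def deformedExpansion {K U V W Q : Type*} [CommRing K] [AddCommGroup Q] [Module K Q]
    (NU : U → U) (NV : V → V) (NW : W → W) (NQ : Module.End K Q) (t : K)
    (T : U → V → W → Q) (u : U) (v : V) (w : W) : Q :=
  T u v w
  + t • (T (NU u) v w + T u (NV v) w + T u v (NW w) - NQ (T u v w))
  + t • t • (T (NU u) (NV v) w + T (NU u) v (NW w) + T u (NV v) (NW w)
    - (NQ (T (NU u) v w) + NQ (T u (NV v) w) + NQ (T u v (NW w))) + NQ (NQ (T u v w)))

theorem deformedExpansion_sub_eq_sub {K U V W Q : Type*} [CommRing K]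
    [AddCommGroup Q] [Module K Q]
    (T₁ T₂ T₃ T₄ : U → V → W → Q) (NU : U → U) (NV : V → V) (NW : W → W) (NQ : Module.End K Q)
    (h : ∀ u v w, T₁ u v w - T₂ u v w = T₃ u v w - T₄ u v w)
    (t : K) (u : U) (v : V) (w : W) :
    deformedExpansion NU NV NW NQ t T₁ u v w - deformedExpansion NU NV NW NQ t T₂ u v w =
      deformedExpansion NU NV NW NQ t T₃ u v w - deformedExpansion NU NV NW NQ t T₄ u v w := by
  have e : ∀ u v w, T₁ u v w = T₃ u v w - T₄ u v w + T₂ u v w := fun u v w => by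
    rw [← h, sub_add_cancel]
  simp only [deformedExpansion, e, map_add, map_sub]
  module

set_option maxHeartbeats 1000000 in
/-- a Nijenhuis operator `N` together with a compatible `S ∈ End(M)`
generates a (trivial) infinitesimal deformation of the `A`-bimodule `M`: for every
scalar `t`, `·_t = · + tω` is anti-flexible and `(M, l + tφ, r + tψ)` is a bimodule
over `(A, ·_t)`, where `ω(a,b) = N(a)·b + a·N(b) − N(a·b)`,
`φ(a) = l(N(a)) + l(a)∘S − S∘l(a)` and `ψ(a) = r(N(a)) + r(a)∘S − S∘r(a)`. -/
theorem nijenhuis_infinitesimal_deformation {K A M : Type*} [Field K]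
    [AddCommGroup A] [Module K A] [AddCommGroup M] [Module K M]
    (mul : A →ₗ[K] A →ₗ[K] A) (hA : AntiFlexible fun a b => mul a b)
    (l r : A →ₗ[K] Module.End K M) (hbim : IsBimodule mul l r)
    (N : A →ₗ[K] A) (hN : IsNijenhuis (fun a b => mul a b) N)
    (S : Module.End K M)
    (hSl : ∀ (a : A) (m : M),
      l (N a) (S m) = S (l (N a) m + l a (S m) - S (l a m)))
    (hSr : ∀ (a : A) (m : M),
      r (N a) (S m) = S (r (N a) m + r a (S m) - S (r a m))) :
    ∀ t : K,
      AntiFlexible (fun a b : A =>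
        mul a b + t • (mul (N a) b + mul a (N b) - N (mul a b))) ∧
      IsBimodulePt
        (fun a b : A => mul a b + t • (mul (N a) b + mul a (N b) - N (mul a b)))
        (fun (a : A) (m : M) => l a m + t • (l (N a) m + l a (S m) - S (l a m)))
        (fun (a : A) (m : M) => r a m + t • (r (N a) m + r a (S m) - S (r a m))) := by
  intro t
  have hl' : ∀ (m : M) (a : A), LinearMap.flip l (S m) (N a) =
      S (LinearMap.flip l (S m) a + LinearMap.flip l m (N a) - S (LinearMap.flip l m a)) :=
    fun m a => by
      simp only [LinearMap.flip_apply, hSl, add_comm]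
  have hr' : ∀ (m : M) (a : A), LinearMap.flip r (S m) (N a) =
      S (LinearMap.flip r (S m) a + LinearMap.flip r m (N a) - S (LinearMap.flip r m a)) :=
    fun m a => by
      simp only [LinearMap.flip_apply, hSr, add_comm]
  have hN' : ∀ b a : A, LinearMap.flip mul (N b) (N a) =
      N (LinearMap.flip mul (N b) a + LinearMap.flip mul b (N a) - N (LinearMap.flip mul b a)) :=
    fun b a => by
      rw [LinearMap.flip_apply, add_comm]; exact hN a b
  have hmulmul := fun a b c => deformed_comp_eq mul mul N N N N N hN hN t a b c _ rfl
  have hmulmul' := fun b c a => deformed_comp_eq mul mul.flip N N N N N hN hN' t b c a _ rfl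
  have hlmul := fun a b m => deformed_comp_eq mul l N N S N S hN hSl t a b m _ rfl
  have hrmul := fun a b m => deformed_comp_eq mul r N N S N S hN hSr t a b m _ rfl
  have hll := fun b m a => deformed_comp_eq l (LinearMap.flip l) N S N S S hSl hl' t b m a _ rfl
  have hlr := fun b m a => deformed_comp_eq r (LinearMap.flip l) N S N S S hSr hl' t b m a _ rfl
  have hrl := fun b m a => deformed_comp_eq l (LinearMap.flip r) N S N S S hSl hr' t b m a _ rfl
  have hrr := fun b m a => deformed_comp_eq r (LinearMap.flip r) N S N S S hSr hr' t b m a _ rfl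
  simp only [LinearMap.flip_apply] at hmulmul' hll hlr hrl hrr
  refine ⟨fun a b c => ?_, fun a b m => ?_, fun a b m => ?_⟩
    <;> beta_reduce
  · have key := deformedExpansion_sub_eq_sub (fun a b c => mul (mul a b) c)
      (fun a b c => mul a (mul b c)) (fun a b c => mul (mul c b) a)
      (fun a b c => mul c (mul b a)) N N N N hA t a b c
    simp only [deformedExpansion] at key
    linear_combination (norm := module) key + hmulmul a b c - hmulmul' b c a - hmulmul c b a
      + hmulmul' b a c
  · have key := deformedExpansion_sub_eq_sub (fun a b m => l (mul a b) m)
      (fun a b m => l a (l b m)) (fun a b m => r a (r b m))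
      (fun a b m => r (mul b a) m) N N S S
      (fun a b m => LinearMap.congr_fun (hbim.1 a b) m) t a b m
    simp only [deformedExpansion] at key
    linear_combination (norm := module) key + hlmul a b m - hll b m a - hrr b m a + hrmul b a m
  · have key := deformedExpansion_sub_eq_sub (fun a b m => l a (r b m))
      (fun a b m => r b (l a m)) (fun a b m => l b (r a m))
      (fun a b m => r a (l b m)) N N S S
      (fun a b m => LinearMap.congr_fun (hbim.2 a b) m) t a b m
    simp only [deformedExpansion] at key
    linear_combination (norm := module) key + hlr b m a - hrl a m b - hlr a m b + hrl b m a
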